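/- Let G be a finite simple graph and let S be a maximum critical independent set of G. If G is a König-Egerváry graph, then 2α(G) = d(ker(G)) + |N[S]|, and consequently 2α(G) ≤ |ker(G)| + |N[S]|. -/

import Mathlib

/-- `S` is an independent set in `G`: no two of its vertices are adjacent. -/
def IndepSet {V : Type*} (G : SimpleGraph V) (S : Set V) : Prop :=
  ∀ ⦃u⦄, u ∈ S → ∀ ⦃v⦄, v ∈ S → ¬G.Adj u v

/-- The independence number `α(G)`. -/
noncomputable def indNum {V : Type*} (G : SimpleGraph V) : ℕ :=
  sSup {n : ℕ | ∃ S : Set V, IndepSet G S ∧ S.ncard = n}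

/-- `Ω(G)`: the family of maximum independent sets of `G`. -/
def maxIndepFam {V : Type*} (G : SimpleGraph V) : Set (Set V) :=
  {S | IndepSet G S ∧ S.ncard = indNum G}

/-- `N(X)`: the neighborhood of a set of vertices. -/
def nbhd {V : Type*} (G : SimpleGraph V) (X : Set V) : Set V :=
  {v | ∃ x ∈ X, G.Adj v x}

/-- `N[X] = N(X) ∪ X`: the closed neighborhood of a set of vertices. -/
def closedNbhd {V : Type*} (G : SimpleGraph V) (X : Set V) : Set V :=
  nbhd G X ∪ X

/-- The difference `d(X) = |X| - |N(X)|`. -/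
noncomputable def diffd {V : Type*} (G : SimpleGraph V) (X : Set V) : ℤ :=
  (X.ncard : ℤ) - ((nbhd G X).ncard : ℤ)

/-- The critical difference `d(G) = max {d(X) : X ⊆ V(G)}`. -/
noncomputable def critDiff {V : Type*} (G : SimpleGraph V) : ℤ :=
  sSup {d : ℤ | ∃ X : Set V, diffd G X = d}

/-- `X` is a critical set if `d(X) = d(G)`. -/
def IsCritical {V : Type*} (G : SimpleGraph V) (X : Set V) : Prop :=
  diffd G X = critDiff G

/-- `MaxCritIndep(G)`: the family of critical independent sets of maximum cardinality. -/
def maxCritIndepFam {V : Type*} (G : SimpleGraph V) : Set (Set V) :=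
  {S | IndepSet G S ∧ IsCritical G S ∧
    ∀ T : Set V, IndepSet G T → IsCritical G T → T.ncard ≤ S.ncard}

/-- The critical independence number `α'(G)`. -/
noncomputable def critIndNum {V : Type*} (G : SimpleGraph V) : ℕ :=
  sSup {n : ℕ | ∃ S : Set V, IndepSet G S ∧ IsCritical G S ∧ S.ncard = n}

/-- `ker(G)`: the intersection of all critical independent sets. -/
def kerSet {V : Type*} (G : SimpleGraph V) : Set V :=
  ⋂₀ {A : Set V | IndepSet G A ∧ IsCritical G A}

/-- `nucleus(G)`: the intersection of all maximum critical independent sets. -/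
def nucleus {V : Type*} (G : SimpleGraph V) : Set V :=
  ⋂₀ maxCritIndepFam G

/-- `diadem(G)`: the union of all maximum critical independent sets. -/
def diadem {V : Type*} (G : SimpleGraph V) : Set V :=
  ⋃₀ maxCritIndepFam G

/-- `core(G)`: the intersection of all maximum independent sets. -/
def coreSet {V : Type*} (G : SimpleGraph V) : Set V :=
  ⋂₀ maxIndepFam G

/-- `corona(G)`: the union of all maximum independent sets. -/
def coronaSet {V : Type*} (G : SimpleGraph V) : Set V :=
  ⋃₀ maxIndepFam G

/-- A matching in `G`: a set of pairwise non-incident edges of `G`. -/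
def IsMatchingSet {V : Type*} (G : SimpleGraph V) (M : Set (Sym2 V)) : Prop :=
  M ⊆ G.edgeSet ∧ M.Pairwise fun e f => ∀ v, v ∈ e → v ∉ f

/-- The matching number `μ(G)`. -/
noncomputable def matchNum {V : Type*} (G : SimpleGraph V) : ℕ :=
  sSup {n : ℕ | ∃ M : Set (Sym2 V), IsMatchingSet G M ∧ M.ncard = n}

/-- `G` is a König-Egerváry graph if `α(G) + μ(G) = |V(G)|`. -/
def IsKonigEgervary {V : Type*} (G : SimpleGraph V) : Prop :=
  indNum G + matchNum G = Nat.card V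

/-- `Γ` is a König-Egerváry collection: a family of independent sets with
`|⋂Γ| + |⋃Γ| = 2α(G)`. -/
def IsKECollection {V : Type*} (G : SimpleGraph V) (Γ : Set (Set V)) : Prop :=
  (∀ S ∈ Γ, IndepSet G S) ∧ (⋂₀ Γ).ncard + (⋃₀ Γ).ncard = 2 * indNum G

theorem nbhd_mono {V : Type*} (G : SimpleGraph V) {A B : Set V} (h : A ⊆ B) :
    nbhd G A ⊆ nbhd G B := fun _ ⟨x, hx, ha⟩ => ⟨x, h hx, ha⟩

theorem nbhd_union {V : Type*} (G : SimpleGraph V) (A B : Set V) :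
    nbhd G (A ∪ B) = nbhd G A ∪ nbhd G B := by
  ext v
  simp only [nbhd, Set.mem_union, Set.mem_ofPred_eq, or_and_right, exists_or]

theorem IndepSet.disjoint_nbhd {V : Type*} {G : SimpleGraph V} {A : Set V}
    (hA : IndepSet G A) : Disjoint (nbhd G A) A :=
  Set.disjoint_left.2 fun _ ⟨_, hx, ha⟩ hv => hA hv hx ha

theorem IndepSet.mono {V : Type*} {G : SimpleGraph V} {A B : Set V}
    (hB : IndepSet G B) (h : A ⊆ B) : IndepSet G A :=
  fun _ hu _ hv => hB (h hu) (h hv)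

theorem IndepSet.ncard_nbhd_add_ncard_le {V : Type*} [Finite V] {G : SimpleGraph V} {A : Set V}
    (hA : IndepSet G A) : (nbhd G A).ncard + A.ncard ≤ Nat.card V := by
  rw [← Set.ncard_union_eq hA.disjoint_nbhd]
  exact Set.ncard_le_card _

/-- The difference function is supermodular. -/
theorem diffd_add_diffd_le {V : Type*} [Finite V] (G : SimpleGraph V) (A B : Set V) :
    diffd G A + diffd G B ≤ diffd G (A ∪ B) + diffd G (A ∩ B) := by
  have h1 := Set.ncard_union_add_ncard_inter A B
  have h2 := Set.ncard_union_add_ncard_inter (nbhd G A) (nbhd G B)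
  have h3 : (nbhd G (A ∩ B)).ncard ≤ (nbhd G A ∩ nbhd G B).ncard :=
    Set.ncard_le_ncard (Set.subset_inter (nbhd_mono G Set.inter_subset_left)
      (nbhd_mono G Set.inter_subset_right))
  rw [← nbhd_union] at h2
  unfold diffd
  omega

theorem diffd_le_critDiff {V : Type*} [Finite V] (G : SimpleGraph V) (X : Set V) :
    diffd G X ≤ critDiff G :=
  le_csSup (Set.finite_range (diffd G)).bddAbove ⟨X, rfl⟩

theorem IsCritical.inter {V : Type*} [Finite V] {G : SimpleGraph V} {A B : Set V}
    (hA : IsCritical G A) (hB : IsCritical G B) : IsCritical G (A ∩ B) := by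
  have h1 := diffd_add_diffd_le G A B
  have h2 := diffd_le_critDiff G (A ∪ B)
  have h3 := diffd_le_critDiff G (A ∩ B)
  unfold IsCritical at *
  omega

theorem isCritical_kerSet {V : Type*} [Finite V] {G : SimpleGraph V} {S : Set V}
    (hS : IndepSet G S) (hc : IsCritical G S) : IsCritical G (kerSet G) := by
  obtain ⟨A, ⟨hA, hAc⟩, hmin⟩ := Set.exists_min_image
    {A : Set V | IndepSet G A ∧ IsCritical G A} Set.ncard (Set.toFinite _) ⟨S, hS, hc⟩
  have hker : kerSet G = A := by
    refine Set.Subset.antisymm (Set.sInter_subset_of_mem ⟨hA, hAc⟩) ?_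
    rintro v hv B ⟨_, hBc⟩
    have h := hmin (A ∩ B) ⟨hA.mono Set.inter_subset_left, hAc.inter hBc⟩
    rw [← Set.eq_of_subset_of_ncard_le Set.inter_subset_left h] at hv
    exact hv.2
  rwa [hker]

theorem exists_indepSet_ncard_eq_indNum {V : Type*} [Finite V] (G : SimpleGraph V) :
    ∃ S : Set V, IndepSet G S ∧ S.ncard = indNum G :=
  Nat.sSup_mem (s := {n : ℕ | ∃ S : Set V, IndepSet G S ∧ S.ncard = n})
    ⟨0, ∅, fun _ h => h.elim, Set.ncard_empty V⟩
    ⟨Nat.card V, by rintro _ ⟨S, _, rfl⟩; exact Set.ncard_le_card S⟩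

theorem IndepSet.ncard_le_indNum {V : Type*} [Finite V] {G : SimpleGraph V} {S : Set V}
    (hS : IndepSet G S) : S.ncard ≤ indNum G :=
  le_csSup ⟨Nat.card V, by rintro _ ⟨S, _, rfl⟩; exact Set.ncard_le_card S⟩ ⟨S, hS, rfl⟩

theorem exists_isMatchingSet_ncard_eq_matchNum {V : Type*} [Finite V] (G : SimpleGraph V) :
    ∃ M : Set (Sym2 V), IsMatchingSet G M ∧ M.ncard = matchNum G :=
  Nat.sSup_mem (s := {n : ℕ | ∃ M : Set (Sym2 V), IsMatchingSet G M ∧ M.ncard = n})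
    ⟨0, ∅, ⟨Set.empty_subset _, Set.pairwise_empty _⟩, Set.ncard_empty _⟩
    ⟨Nat.card (Sym2 V), by rintro _ ⟨M, _, rfl⟩; exact Set.ncard_le_card M⟩

theorem IsMatchingSet.eq_of_mem {V : Type*} {G : SimpleGraph V} {M : Set (Sym2 V)}
    (hM : IsMatchingSet G M) {e f : Sym2 V} (he : e ∈ M) (hf : f ∈ M) {v : V}
    (hve : v ∈ e) (hvf : v ∈ f) : e = f :=
  by_contra fun h => hM.2 he hf h v hve hvf

theorem IsMatchingSet.ncard_support {V : Type*} [Finite V] {G : SimpleGraph V}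
    {M : Set (Sym2 V)} (hM : IsMatchingSet G M) :
    {v | ∃ e ∈ M, v ∈ e}.ncard = 2 * M.ncard := by
  classical
  have := Fintype.ofFinite V
  have hsupp : {v | ∃ e ∈ M, v ∈ e} = (M.toFinset.biUnion Sym2.toFinset : Finset V) := by
    ext v
    simp
  rw [hsupp, Set.ncard_coe_finset, Finset.card_biUnion, Finset.sum_congr rfl (g := fun _ => 2),
    Finset.sum_const, Set.ncard_eq_toFinset_card', smul_eq_mul, mul_comm]
  · intro e he
    exact Sym2.card_toFinset_of_not_isDiag e
      (G.not_isDiag_of_mem_edgeSet (hM.1 (Set.mem_toFinset.1 he)))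
  · intro e he f hf hne
    refine Finset.disjoint_left.2 ?_
    intro v hve hvf
    exact hM.2 (Set.mem_toFinset.1 he) (Set.mem_toFinset.1 hf) hne v
      (Sym2.mem_toFinset.1 hve) (Sym2.mem_toFinset.1 hvf)

theorem IsMatchingSet.ncard_inter_support_le {V : Type*} [Finite V] {G : SimpleGraph V}
    {M : Set (Sym2 V)} (hM : IsMatchingSet G M) (X : Set V) :
    (X ∩ {v | ∃ e ∈ M, v ∈ e}).ncard ≤ (nbhd G X).ncard := by
  have hpartner : ∀ v ∈ X ∩ {v | ∃ e ∈ M, v ∈ e}, ∃ w, s(v, w) ∈ M := by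
    rintro v ⟨-, e, he, w, rfl⟩
    exact ⟨w, he⟩
  choose! p hp using hpartner
  refine Set.ncard_le_ncard_of_injOn p (fun v hv => ⟨v, hv.1, ?_⟩) ?_
  · exact (G.mem_edgeSet.1 (hM.1 (hp v hv))).symm
  · intro v hv w hw hvw
    have h := hM.eq_of_mem (hp v hv) (hp w hw) (Sym2.mem_mk_right _ _)
      (hvw ▸ Sym2.mem_mk_right _ _)
    rw [hvw] at h
    exact Sym2.congr_left.1 h

theorem diffd_le_card_sub_matchNum {V : Type*} [Finite V] (G : SimpleGraph V) (X : Set V) :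
    diffd G X ≤ Nat.card V - 2 * matchNum G := by
  obtain ⟨M, hM, hcard⟩ := exists_isMatchingSet_ncard_eq_matchNum G
  have h1 := hM.ncard_support
  have h2 := hM.ncard_inter_support_le X
  have h3 := Set.ncard_inter_add_ncard_sdiff_eq_ncard X {v | ∃ e ∈ M, v ∈ e}
  have h4 : (X \ {v | ∃ e ∈ M, v ∈ e}).ncard ≤ ({v | ∃ e ∈ M, v ∈ e}ᶜ).ncard :=
    Set.ncard_le_ncard fun _ h => h.2
  have h5 := Set.ncard_add_ncard_compl {v | ∃ e ∈ M, v ∈ e}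
  unfold diffd
  omega

/-- In a König-Egerváry graph every maximum independent set is critical. -/
theorem IsKonigEgervary.isCritical {V : Type*} [Finite V] {G : SimpleGraph V}
    (hKE : IsKonigEgervary G) {I : Set V} (hI : IndepSet G I) (hcard : I.ncard = indNum G) :
    IsCritical G I := by
  refine le_antisymm (diffd_le_critDiff G I) (csSup_le ⟨_, I, rfl⟩ ?_)
  rintro _ ⟨X, rfl⟩
  have h1 := diffd_le_card_sub_matchNum G X
  have h2 := hI.ncard_nbhd_add_ncard_le
  unfold IsKonigEgervary at hKE
  unfold diffd at *
  omega

/-- If `S` is a maximum critical independent set of `G` and `G` is a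
König-Egerváry graph, then `2α(G) = d(ker(G)) + |N[S]|`, and consequently
`2α(G) ≤ |ker(G)| + |N[S]|`. -/
theorem stmt13 {V : Type*} [Fintype V] (G : SimpleGraph V)
    (S : Set V) (hS : S ∈ maxCritIndepFam G) (hKE : IsKonigEgervary G) :
    (2 * indNum G : ℤ) = diffd G (kerSet G) + ((closedNbhd G S).ncard : ℤ) ∧
    2 * indNum G ≤ (kerSet G).ncard + (closedNbhd G S).ncard := by
  obtain ⟨hSi, hSc, hSmax⟩ := hS
  obtain ⟨I, hI, hIcard⟩ := exists_indepSet_ncard_eq_indNum G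
  have hIc := hKE.isCritical hI hIcard
  have hker := isCritical_kerSet hSi hSc
  have h1 := hSmax I hI hIc
  have h2 := hSi.ncard_le_indNum
  have h3 := diffd_le_card_sub_matchNum G S
  have h4 := hSi.ncard_nbhd_add_ncard_le
  have h5 : (closedNbhd G S).ncard = (nbhd G S).ncard + S.ncard :=
    Set.ncard_union_eq hSi.disjoint_nbhd
  unfold IsCritical at hker hSc
  unfold IsKonigEgervary at hKE
  unfold diffd at *
  omega
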